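/- Let τ1, τ2 : Ω × Ω → {C,D} be deterministic memory-two strategies forming a mutual reinforcement learning equilibrium, i.e., there exist Q1, Q2 : {C,D} × Ω × Ω → ℝ such that Q1 satisfies the player-1 memory-two Bellman optimality equation against τ2 with τ1 strictly greedy for Q1, and Q2 satisfies the player-2 memory-two Bellman optimality equation against τ1 with τ2 strictly greedy for Q2. Then for every state s1, either τ1(s1,s2) = τ2(s1,s2) for all s2, or τ1(s1,s2) ≠ τ2(s1,s2) for all s2. -/

import Mathlib

inductive Act where
  | C : Act
  | D : Act
deriving DecidableEq

open Act

abbrev St : Type := Act × Act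

/-- Player 1's payoff in the prisoner's dilemma. -/
def r1 (R S T P : ℝ) : Act → Act → ℝ
  | C, C => R
  | C, D => S
  | D, C => T
  | D, D => P

/-- Swap the roles of the two players in a state. -/
def pi' (s : St) : St := (s.2, s.1)

/-- A strategy strictly greedy for a value function that sees the second-to-last state only
through the opponent's action is itself a function of the last state and that action. -/
theorem action_eq_of_opponent_action_eq {τ τ' : St → St → Act} {Q : Act → St → St → ℝ}
    {F : Act → St → Act → ℝ} (hQ : ∀ σ s1 s2, Q σ s1 s2 = F σ s1 (τ' s1 s2))
    (hg : ∀ s1 s2, (τ s1 s2 = C → Q C s1 s2 > Q D s1 s2) ∧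
      (τ s1 s2 = D → Q D s1 s2 > Q C s1 s2))
    (s1 a b : St) (h : τ' s1 a = τ' s1 b) : τ s1 a = τ s1 b := by
  have hab (σ : Act) : Q σ s1 a = Q σ s1 b := by rw [hQ, hQ, h]
  have ha := hg s1 a
  have hb := hg s1 b
  rw [hab, hab] at ha
  cases h1 : τ s1 a <;> cases h2 : τ s1 b
  · rfl
  · exact absurd (ha.1 h1) (hb.2 h2).asymm
  · exact absurd (ha.2 h1) (hb.1 h2).asymm
  · rfl

/-- Two action-valued functions with the same level sets agree everywhere or nowhere. -/
theorem forall_eq_or_forall_ne_of_eq_iff {α : Type*} {f g : α → Act}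
    (h : ∀ a b, f a = f b ↔ g a = g b) : (∀ a, f a = g a) ∨ (∀ a, f a ≠ g a) := by
  by_contra! ⟨⟨a, ha⟩, ⟨b, hb⟩⟩
  have hab := h a b
  cases hfa : f a <;> cases hfb : f b <;> cases hga : g a <;> cases hgb : g b <;> simp_all

/-- in a mutual reinforcement learning equilibrium formed by deterministic
memory-two strategies, for each last state `s1` the two strategies either agree for all
second-to-last states or disagree for all of them. -/
theorem stmt_2 (R S T P γ : ℝ) (hTR : T > R) (hRP : R > P) (hPS : P > S)
    (h2R : 2 * R > T + S) (hγ0 : 0 ≤ γ) (hγ1 : γ < 1)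
    (τ1 τ2 : St → St → Act) (Q1 Q2 : Act → St → St → ℝ)
    (hQ1 : ∀ σ s1 s2, Q1 σ s1 s2 =
      r1 R S T P σ (τ2 s1 s2) +
        γ * max (Q1 C (σ, τ2 s1 s2) s1) (Q1 D (σ, τ2 s1 s2) s1))
    (hg1 : ∀ s1 s2, (τ1 s1 s2 = C → Q1 C s1 s2 > Q1 D s1 s2) ∧
      (τ1 s1 s2 = D → Q1 D s1 s2 > Q1 C s1 s2))
    (hQ2 : ∀ σ s1 s2, Q2 σ s1 s2 =
      r1 R S T P σ (τ1 s1 s2) +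
        γ * max (Q2 C (τ1 s1 s2, σ) s1) (Q2 D (τ1 s1 s2, σ) s1))
    (hg2 : ∀ s1 s2, (τ2 s1 s2 = C → Q2 C s1 s2 > Q2 D s1 s2) ∧
      (τ2 s1 s2 = D → Q2 D s1 s2 > Q2 C s1 s2)) :
    ∀ s1 : St, (∀ s2, τ1 s1 s2 = τ2 s1 s2) ∨ (∀ s2, τ1 s1 s2 ≠ τ2 s1 s2) := by
  intro s1
  refine forall_eq_or_forall_ne_of_eq_iff fun a b => ⟨?_, ?_⟩
  · exact action_eq_of_opponent_action_eq
      (F := fun σ s x => r1 R S T P σ x + γ * max (Q2 C (x, σ) s) (Q2 D (x, σ) s))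
      hQ2 hg2 s1 a b
  · exact action_eq_of_opponent_action_eq
      (F := fun σ s x => r1 R S T P σ x + γ * max (Q1 C (σ, x) s) (Q1 D (σ, x) s))
      hQ1 hg1 s1 a b
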